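/- Let φ : ℝⁿ → ℝ be a smooth strictly convex function whose gradient map ∇φ is a diffeomorphism from ℝⁿ onto the open convex set Δ_φ of subgradients of φ, and let u : Δ_φ → ℝ be a bounded continuous concave function. For λ ∈ ℝ set A_λ := {y ∈ Δ_φ : u(y) ≥ λ} and φ_λ(x) := sup{ψ(x) : ψ : ℝⁿ → ℝ convex, ψ ≤ φ on ℝⁿ, Δ_ψ ⊆ A_λ} (with φ_λ(x) := −∞ when A_λ = ∅), and for t ≥ 0 define φ̂_t(x) := sup_{λ∈ℝ}(φ_λ(x) + t·λ). Then for every x ∈ ℝⁿ, φ̂_0(x) = φ(x) and the right derivative of t ↦ φ̂_t(x) at t = 0 exists and equals u(∇φ(x)). -/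

import Mathlib

open scoped RealInnerProductSpace

/-- The set of subgradients of a function `ψ : ℝⁿ → ℝ`: those `y` such that
`x ↦ ψ(x) − ⟨x,y⟩` is bounded below. -/
def subgradSet {n : ℕ} (ψ : EuclideanSpace ℝ (Fin n) → ℝ) : Set (EuclideanSpace ℝ (Fin n)) :=
  {y | BddBelow (Set.range fun x => ψ x - ⟪x, y⟫)}

/-- The Legendre transform in λ of the curve of envelopes λ ↦ φ_λ, where
φ_λ = sup {ψ : ψ convex, ψ ≤ φ, Δ_ψ ⊆ {u ≥ λ} ∩ Δ_φ} (interpreted as −∞ when no such ψ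
exists): `φ̂_t(x) = sup_λ (φ_λ(x) + t·λ)`, realized as a supremum of a set of reals. -/
noncomputable def hatPhi {n : ℕ} (φ u : EuclideanSpace ℝ (Fin n) → ℝ) (t : ℝ)
    (x : EuclideanSpace ℝ (Fin n)) : ℝ :=
  sSup {v : ℝ | ∃ lam : ℝ, ∃ ψ : EuclideanSpace ℝ (Fin n) → ℝ,
    ConvexOn ℝ Set.univ ψ ∧ (∀ z, ψ z ≤ φ z) ∧
    subgradSet ψ ⊆ {y ∈ subgradSet φ | lam ≤ u y} ∧ v = ψ x + t * lam}

/-- Tangent plane inequality for a differentiable convex function. -/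
theorem ConvexOn.add_inner_gradient_le {n : ℕ} {φ : EuclideanSpace ℝ (Fin n) → ℝ}
    (hconv : ConvexOn ℝ Set.univ φ) {x : EuclideanSpace ℝ (Fin n)}
    (hd : DifferentiableAt ℝ φ x) (z : EuclideanSpace ℝ (Fin n)) :
    φ x + ⟪gradient φ x, z - x⟫ ≤ φ z := by
  have hline : HasDerivAt (fun s : ℝ => x + s • (z - x)) (z - x) 0 := by
    simpa using ((hasDerivAt_id (0 : ℝ)).smul_const (z - x)).const_add x
  have hder : HasDerivAt (fun s : ℝ => φ (x + s • (z - x))) ⟪gradient φ x, z - x⟫ 0 := by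
    have hf : HasFDerivAt φ (InnerProductSpace.toDual ℝ _ (gradient φ x))
        (x + (0 : ℝ) • (z - x)) := by
      simpa using hd.hasGradientAt.hasFDerivAt
    exact hf.comp_hasDerivAt (0 : ℝ) hline
  have hc : ConvexOn ℝ Set.univ (fun s : ℝ => φ (x + s • (z - x))) := by
    have := hconv.comp_affineMap (AffineMap.lineMap x z : ℝ →ᵃ[ℝ] EuclideanSpace ℝ (Fin n))
    simpa [Function.comp_def, AffineMap.lineMap_apply, add_comm] using this
  have := hc.le_slope_of_hasDerivAt (Set.mem_univ 0) (Set.mem_univ 1) one_pos hder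
  simp only [slope_def_field, one_smul, zero_smul, add_zero, add_sub_cancel, sub_zero, div_one]
    at this
  linarith

/-- The only subgradient of an affine function is its slope. -/
theorem subgradSet_affine {n : ℕ} (y : EuclideanSpace ℝ (Fin n)) (c : ℝ) :
    subgradSet (fun z => ⟪y, z⟫ + c) = {y} := by
  ext w
  simp only [subgradSet, Set.mem_ofPred_eq, Set.mem_singleton_iff]
  constructor
  · rintro ⟨b, hb⟩
    by_contra hne
    have hpos : 0 < ⟪w - y, w - y⟫ := by
      rw [real_inner_self_eq_norm_sq]
      have := norm_pos_iff.mpr (sub_ne_zero.mpr hne)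
      positivity
    have h := hb ⟨((c - b + 1) / ⟪w - y, w - y⟫) • (w - y), rfl⟩
    have hcalc : ⟪y, ((c - b + 1) / ⟪w - y, w - y⟫) • (w - y)⟫ + c
        - ⟪((c - b + 1) / ⟪w - y, w - y⟫) • (w - y), w⟫ = b - 1 := by
      rw [real_inner_comm _ y, ← sub_eq_zero]
      have : ⟪((c - b + 1) / ⟪w - y, w - y⟫) • (w - y), w - y⟫ = c - b + 1 := by
        rw [real_inner_smul_left, div_mul_cancel₀ _ hpos.ne']
      rw [inner_sub_right] at this
      linarith
    simp only [hcalc] at h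
    linarith
  · rintro rfl
    refine ⟨c, ?_⟩
    rintro _ ⟨z, rfl⟩
    simp [real_inner_comm]

/-- A convex function on `ℝⁿ` has affine minorants with values arbitrarily close at a point. -/
theorem ConvexOn.exists_inner_add_le {n : ℕ} {ψ : EuclideanSpace ℝ (Fin n) → ℝ}
    (hψ : ConvexOn ℝ Set.univ ψ) {x : EuclideanSpace ℝ (Fin n)} {a : ℝ} (ha : a < ψ x) :
    ∃ y ∈ subgradSet ψ, ∀ z, a + ⟪y, z - x⟫ ≤ ψ z := by
  obtain ⟨l, c, hle, heq⟩ := hψ.exists_affine_le_of_lt (𝕜 := ℝ) (Set.mem_univ x) ha isClosed_univ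
    (hψ.continuousOn isOpen_univ).lowerSemicontinuousOn
  have hl : ∀ z, ⟪(InnerProductSpace.toDual ℝ _).symm l, z⟫ = l z := fun z => by simp
  have hle' : ∀ z, l z + c ≤ ψ z := fun z => by simpa using hle ⟨z, Set.mem_univ z⟩
  have heq' : l x + c = a := by simpa using heq
  refine ⟨(InnerProductSpace.toDual ℝ _).symm l, ⟨c, ?_⟩, fun z => ?_⟩
  · rintro _ ⟨z, rfl⟩
    have := hle' z
    simp only [real_inner_comm _ z, hl]
    linarith
  · rw [hl, map_sub]
    linarith [hle' z]

/-- Affine minorants of `φ` whose slope stays away from the gradient at `x` stay a definite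
amount below `φ` at `x`. -/
theorem exists_gap_of_le_norm_sub_gradient {n : ℕ} {φ : EuclideanSpace ℝ (Fin n) → ℝ}
    {x : EuclideanSpace ℝ (Fin n)} (hd : DifferentiableAt ℝ φ x) {r : ℝ} (hr : 0 < r) :
    ∃ c > 0, ∀ (y : EuclideanSpace ℝ (Fin n)) (a : ℝ), r ≤ ‖y - gradient φ x‖ →
      (∀ z, a + ⟪y, z - x⟫ ≤ φ z) → a ≤ φ x - c := by
  have ho := (hasGradientAt_iff_isLittleO.mp hd.hasGradientAt).def (half_pos hr)
  obtain ⟨δ, hδ, hball⟩ := Metric.eventually_nhds_iff.mp ho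
  refine ⟨δ / 2 * (r / 2), by positivity, fun y a hy hle => ?_⟩
  set v := y - gradient φ x with hv
  have hvpos : 0 < ‖v‖ := hr.trans_le hy
  set z := x + (δ / 2 / ‖v‖) • v with hz
  have hzx : z - x = (δ / 2 / ‖v‖) • v := by simp [hz]
  have hnorm : ‖z - x‖ = δ / 2 := by
    rw [hzx, norm_smul, Real.norm_of_nonneg (by positivity), div_mul_cancel₀ _ hvpos.ne']
  have hinner : ⟪v, z - x⟫ = δ / 2 * ‖v‖ := by
    rw [hzx, real_inner_smul_right, real_inner_self_eq_norm_sq]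
    field_simp
  have h1 := hball (y := z) (by rw [dist_eq_norm, hnorm]; linarith)
  rw [hnorm] at h1
  have h2 := (le_abs_self _).trans h1
  have h3 := hle z
  rw [hv, inner_sub_left, ← hv] at hinner
  have h4 : δ / 2 * r ≤ δ / 2 * ‖v‖ := by gcongr
  linarith

/-- For `φ̂_t(x)`, competitors are bounded by `φ(x) + t (u(∇φ(x)) + ε)` when `t` is small. -/
theorem exists_forall_competitor_le {n : ℕ} {φ u : EuclideanSpace ℝ (Fin n) → ℝ}
    {x : EuclideanSpace ℝ (Fin n)} (hd : DifferentiableAt ℝ φ x)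
    (hubdd : BddAbove (u '' subgradSet φ))
    (hucont : ContinuousWithinAt u (subgradSet φ) (gradient φ x)) {ε : ℝ} (hε : 0 < ε) :
    ∃ T > 0, ∀ t, 0 ≤ t → t < T → ∀ (lam : ℝ) (ψ : EuclideanSpace ℝ (Fin n) → ℝ),
      ConvexOn ℝ Set.univ ψ → (∀ z, ψ z ≤ φ z) →
      subgradSet ψ ⊆ {y ∈ subgradSet φ | lam ≤ u y} →
      ψ x + t * lam ≤ φ x + t * (u (gradient φ x) + ε) := by
  obtain ⟨M, hM⟩ := hubdd
  obtain ⟨r, hr, hur⟩ := Metric.continuousWithinAt_iff.mp hucont ε hε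
  obtain ⟨c, hc, hgap⟩ := exists_gap_of_le_norm_sub_gradient hd hr
  have hpos : 0 < |M - u (gradient φ x)| + 1 := by positivity
  refine ⟨c / (|M - u (gradient φ x)| + 1), by positivity, fun t ht htT lam ψ hψ hle hsub => ?_⟩
  rw [lt_div_iff₀ hpos] at htT
  rw [← le_sub_iff_add_le]
  refine le_of_forall_lt fun a ha => ?_
  obtain ⟨b, hab, hb⟩ := exists_between ha
  refine hab.trans_le ?_
  obtain ⟨y, hy, hyle⟩ := hψ.exists_inner_add_le hb
  obtain ⟨hyφ, hylam⟩ := hsub hy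
  rcases lt_or_ge ‖y - gradient φ x‖ r with hlt | hge
  · have h1 := hur hyφ (by rwa [dist_eq_norm])
    rw [Real.dist_eq] at h1
    have h2 : lam ≤ u (gradient φ x) + ε := by linarith [(abs_lt.mp h1).2]
    have h3 := mul_le_mul_of_nonneg_left h2 ht
    linarith [hle x]
  · have h1 := hgap y b hge fun z => (hyle z).trans (hle z)
    have h2 : lam ≤ M := hylam.trans (hM ⟨y, hyφ, rfl⟩)
    have h3 : lam ≤ u (gradient φ x) + ε + (|M - u (gradient φ x)| + 1) := by
      linarith [le_abs_self (M - u (gradient φ x))]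
    have h4 := mul_le_mul_of_nonneg_left h3 ht
    linarith

/-- with φ smooth strictly convex whose gradient is a diffeomorphism onto the
open convex set Δ_φ of subgradients, and u bounded continuous concave on Δ_φ, for every x
one has φ̂_0(x) = φ(x) and the right derivative of t ↦ φ̂_t(x) at t = 0 exists and equals
u(∇φ(x)). -/
theorem hatPhi_right_derivative_at_zero {n : ℕ}
    (φ : EuclideanSpace ℝ (Fin n) → ℝ)
    (hφ : ContDiff ℝ (⊤ : ℕ∞) φ) (hφconv : StrictConvexOn ℝ Set.univ φ)
    (hΔopen : IsOpen (subgradSet φ)) (hΔconv : Convex ℝ (subgradSet φ))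
    -- the gradient of φ is a diffeomorphism from ℝⁿ onto Δ_φ:
    (g : EuclideanSpace ℝ (Fin n) → EuclideanSpace ℝ (Fin n))
    (hbij : Set.BijOn (gradient φ) Set.univ (subgradSet φ))
    (hg : ContDiffOn ℝ (⊤ : ℕ∞) g (subgradSet φ))
    (hgleft : ∀ x, g (gradient φ x) = x)
    (hgright : ∀ y ∈ subgradSet φ, gradient φ (g y) = y)
    -- u is a bounded continuous concave function on Δ_φ:
    (u : EuclideanSpace ℝ (Fin n) → ℝ)
    (hubdd : BddAbove (u '' subgradSet φ) ∧ BddBelow (u '' subgradSet φ))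
    (hucont : ContinuousOn u (subgradSet φ))
    (huconc : ConcaveOn ℝ (subgradSet φ) u)
    (x : EuclideanSpace ℝ (Fin n)) :
    hatPhi φ u 0 x = φ x ∧
    HasDerivWithinAt (fun t : ℝ => hatPhi φ u t x) (u (gradient φ x)) (Set.Ici 0) 0 := by
  have hd : DifferentiableAt ℝ φ x := hφ.contDiffAt.differentiableAt (by simp)
  have hmem : gradient φ x ∈ subgradSet φ := hbij.mapsTo (Set.mem_univ x)
  have hlower : ∀ t, ∃ lam : ℝ, ∃ ψ : EuclideanSpace ℝ (Fin n) → ℝ,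
      ConvexOn ℝ Set.univ ψ ∧ (∀ z, ψ z ≤ φ z) ∧
      subgradSet ψ ⊆ {y ∈ subgradSet φ | lam ≤ u y} ∧
      φ x + t * u (gradient φ x) = ψ x + t * lam := by
    refine fun t => ⟨u (gradient φ x),
      fun z => ⟪gradient φ x, z⟫ + (φ x - ⟪gradient φ x, x⟫), ?_, fun z => ?_, ?_, by ring⟩
    · exact ((innerₛₗ ℝ (gradient φ x)).convexOn convex_univ).add_const _
    · have := hφconv.convexOn.add_inner_gradient_le hd z
      rw [inner_sub_right] at this
      linarith
    · rw [subgradSet_affine, Set.singleton_subset_iff]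
      exact ⟨hmem, le_rfl⟩
  have hsmall : ∀ ε > 0, ∃ T > 0, ∀ t, 0 ≤ t → t < T →
      φ x + t * u (gradient φ x) ≤ hatPhi φ u t x ∧
      hatPhi φ u t x ≤ φ x + t * (u (gradient φ x) + ε) := by
    intro ε hε
    obtain ⟨T, hT, hbound⟩ := exists_forall_competitor_le hd hubdd.1 (hucont _ hmem) hε
    refine ⟨T, hT, fun t ht htT => ⟨le_csSup ⟨φ x + t * (u (gradient φ x) + ε), ?_⟩ (hlower t),
      csSup_le ⟨_, hlower t⟩ ?_⟩⟩ <;>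
    · rintro _ ⟨lam, ψ, hψ, hle, hsub, rfl⟩
      exact hbound t ht htT lam ψ hψ hle hsub
  have hzero : hatPhi φ u 0 x = φ x := by
    obtain ⟨T, hT, h⟩ := hsmall 1 one_pos
    obtain ⟨h1, h2⟩ := h 0 le_rfl hT
    linarith
  refine ⟨hzero, ?_⟩
  rw [hasDerivWithinAt_iff_isLittleO, Asymptotics.isLittleO_iff]
  intro ε hε
  obtain ⟨T, hT, h⟩ := hsmall ε hε
  filter_upwards [self_mem_nhdsWithin, mem_nhdsWithin_of_mem_nhds (Iio_mem_nhds hT)] with t ht htT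
  obtain ⟨h1, h2⟩ := h t ht htT
  rw [hzero, sub_zero, smul_eq_mul, Real.norm_eq_abs, Real.norm_of_nonneg ht, abs_le]
  have : 0 ≤ ε * t := mul_nonneg hε.le ht
  constructor <;> linarith
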